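/- arXiv:2409.13931 — 4 statements merged into one kernel-verified Lean document; each statement's English description precedes it below -/
import Mathlib

section
/- Let A be a symmetric real m×m matrix, B a symmetric real n×n matrix, and C a real n×m matrix, and let H be the symmetric (m+n)×(m+n) block matrix with blocks [[A, Cᵀ],[C, B]]. Suppose there are constants 0 < μ ≤ L such that μ·I ⪯ H ⪯ L·I in the Loewner order (i.e., H − μ·I and L·I − H are positive semidefinite). Then μ·I ⪯ A ⪯ L·I, and moreover μ·I ⪯ A − CᵀB⁻¹C ⪯ L·I, where B⁻¹ exists because B is positive definite. -/
open Matrix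

/-- **Spectral bounds for the diagonal block and Schur complement.**
If the symmetric block matrix `H = [[A, Cᵀ], [C, B]]` satisfies `μ•I ⪯ H ⪯ L•I` in the Loewner
order, with `0 < μ ≤ L`, then `B` is positive definite (so `B⁻¹` exists), `μ•I ⪯ A ⪯ L•I`, and
`μ•I ⪯ A - CᵀB⁻¹C ⪯ L•I`. -/
theorem schur_complement_spectral_bounds {m n : ℕ}
    (A : Matrix (Fin m) (Fin m) ℝ) (B : Matrix (Fin n) (Fin n) ℝ)
    (C : Matrix (Fin n) (Fin m) ℝ) (hA : A.IsSymm) (hB : B.IsSymm)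
    (μ L : ℝ) (hμ : 0 < μ) (hμL : μ ≤ L)
    (hlow : (Matrix.fromBlocks A Cᵀ C B - μ • (1 : Matrix (Fin m ⊕ Fin n) (Fin m ⊕ Fin n) ℝ)).PosSemidef)
    (hup : (L • (1 : Matrix (Fin m ⊕ Fin n) (Fin m ⊕ Fin n) ℝ) - Matrix.fromBlocks A Cᵀ C B).PosSemidef) :
    B.PosDef ∧
    (A - μ • (1 : Matrix (Fin m) (Fin m) ℝ)).PosSemidef ∧
    (L • (1 : Matrix (Fin m) (Fin m) ℝ) - A).PosSemidef ∧
    ((A - Cᵀ * B⁻¹ * C) - μ • (1 : Matrix (Fin m) (Fin m) ℝ)).PosSemidef ∧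
    (L • (1 : Matrix (Fin m) (Fin m) ℝ) - (A - Cᵀ * B⁻¹ * C)).PosSemidef := by
  have sub_toBlocks : Matrix.fromBlocks A Cᵀ C B -
      μ • (1 : Matrix (Fin m ⊕ Fin n) (Fin m ⊕ Fin n) ℝ) =
      Matrix.fromBlocks (A - μ • 1) Cᵀ C (B - μ • 1) := by
    rw [← Matrix.fromBlocks_one, Matrix.fromBlocks_smul, sub_eq_add_neg, Matrix.fromBlocks_neg,
      Matrix.fromBlocks_add]
    simp [sub_eq_add_neg]
  have hAlow : (A - μ • (1 : Matrix (Fin m) (Fin m) ℝ)).PosSemidef := by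
    rw [sub_toBlocks] at hlow
    exact hlow.submatrix Sum.inl
  have hAup : (L • (1 : Matrix (Fin m) (Fin m) ℝ) - A).PosSemidef := by
    convert hup.submatrix (Sum.inl : Fin m → Fin m ⊕ Fin n) using 1
    ext i j
    simp [Matrix.one_apply]
  have hBpos : B.PosDef := by
    rw [sub_toBlocks] at hlow
    have hBlow : (B - μ • (1 : Matrix (Fin n) (Fin n) ℝ)).PosSemidef := hlow.submatrix Sum.inr
    simpa using Matrix.PosDef.posSemidef_add hBlow (Matrix.PosDef.one.smul hμ)
  have : Invertible B := hBpos.isUnit.invertible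
  refine ⟨hBpos, hAlow, hAup, ?_, ?_⟩
  · have hdiag : (Matrix.fromBlocks (0 : Matrix (Fin m) (Fin m) ℝ) 0 0
        (μ • (1 : Matrix (Fin n) (Fin n) ℝ))).PosSemidef := by
      rw [Matrix.smul_one_eq_diagonal, ← Matrix.diagonal_zero, Matrix.fromBlocks_diagonal]
      refine Matrix.PosSemidef.diagonal fun i => ?_
      cases i <;> simp [hμ.le]
    have hsum := hlow.add hdiag
    rw [sub_toBlocks, Matrix.fromBlocks_add] at hsum
    simp only [add_zero, sub_add_cancel] at hsum
    have hschur := (Matrix.PosDef.fromBlocks₂₂ (A - μ • 1) Cᵀ hBpos).mp (by simpa using hsum)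
    rw [sub_right_comm]
    simpa using hschur
  · have hquad := hBpos.inv.posSemidef.conjTranspose_mul_mul_same C
    rw [Matrix.conjTranspose_eq_transpose_of_trivial] at hquad
    rw [← sub_add]
    exact hAup.add hquad
end

section
/- Let A be a symmetric real m×m matrix, B a symmetric real n×n matrix, and C a real n×m matrix, and suppose the block matrix H = [[A, Cᵀ],[C, B]] satisfies μ·I ⪯ H ⪯ L·I for some constants 0 < μ ≤ L. Define the sequence θ_{k+1} = A⁻¹CᵀB⁻¹C·θ_k starting from any θ₀ ∈ ℝ^m, and let ‖v‖_A := √⟨Av, v⟩ denote the A-weighted norm. Then for every k ≥ 0, ‖θ_k‖_A ≤ ((L − μ)/L)^k · ‖θ₀‖_A; in particular the alternating minimization iterates for the strictly convex quadratic objective f(θ,φ) = ½⟨Aθ,θ⟩ + ½⟨Bφ,φ⟩ + ⟨Cθ,φ⟩ converge linearly to the unique minimizer θ* = 0. -/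
open Matrix

section

variable {m n : Type*} [Fintype m] [Fintype n]

lemma Matrix.sumElim_dotProduct_fromBlocks_mulVec (A : Matrix m m ℝ) (B : Matrix n n ℝ)
    (C : Matrix n m ℝ) (x : m → ℝ) (y : n → ℝ) :
    Sum.elim x y ⬝ᵥ (fromBlocks A Cᵀ C B *ᵥ Sum.elim x y) =
      A *ᵥ x ⬝ᵥ x + 2 * (C *ᵥ x ⬝ᵥ y) + B *ᵥ y ⬝ᵥ y := by
  have h : x ⬝ᵥ Cᵀ *ᵥ y = C *ᵥ x ⬝ᵥ y := by
    rw [mulVec_transpose, dotProduct_comm, ← dotProduct_mulVec, dotProduct_comm]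
  rw [fromBlocks_mulVec]
  simp only [Sum.elim_comp_inl, Sum.elim_comp_inr, sumElim_dotProduct_sumElim, dotProduct_add, h]
  rw [dotProduct_comm x, dotProduct_comm y, dotProduct_comm y]
  ring

lemma Matrix.posDef_of_le_dotProduct {A : Matrix m m ℝ} {μ : ℝ} (hA : A.IsSymm) (hμ : 0 < μ)
    (h : ∀ x, μ * (x ⬝ᵥ x) ≤ A *ᵥ x ⬝ᵥ x) : A.PosDef := by
  refine .of_dotProduct_mulVec_pos (by simpa [IsHermitian] using hA.eq) fun x hx => ?_
  have hpos : 0 < x ⬝ᵥ x := by simpa using dotProduct_star_self_pos_iff.2 hx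
  rw [star_trivial, dotProduct_comm]
  exact (mul_pos hμ hpos).trans_le (h x)

variable [DecidableEq m] [DecidableEq n]
  {A : Matrix m m ℝ} {B : Matrix n n ℝ} {C : Matrix n m ℝ} {μ L : ℝ}

lemma Matrix.le_blockForm_of_posSemidef_sub
    (h : (fromBlocks A Cᵀ C B - μ • (1 : Matrix (m ⊕ n) (m ⊕ n) ℝ)).PosSemidef)
    (x : m → ℝ) (y : n → ℝ) :
    μ * (x ⬝ᵥ x + y ⬝ᵥ y) ≤ A *ᵥ x ⬝ᵥ x + 2 * (C *ᵥ x ⬝ᵥ y) + B *ᵥ y ⬝ᵥ y := by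
  have := h.dotProduct_mulVec_nonneg (Sum.elim x y)
  rw [star_trivial, sub_mulVec, dotProduct_sub, sumElim_dotProduct_fromBlocks_mulVec, smul_mulVec,
    one_mulVec, dotProduct_smul, sumElim_dotProduct_sumElim, smul_eq_mul] at this
  linarith

lemma Matrix.blockForm_le_of_posSemidef_sub
    (h : (L • (1 : Matrix (m ⊕ n) (m ⊕ n) ℝ) - fromBlocks A Cᵀ C B).PosSemidef)
    (x : m → ℝ) (y : n → ℝ) :
    A *ᵥ x ⬝ᵥ x + 2 * (C *ᵥ x ⬝ᵥ y) + B *ᵥ y ⬝ᵥ y ≤ L * (x ⬝ᵥ x + y ⬝ᵥ y) := by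
  have := h.dotProduct_mulVec_nonneg (Sum.elim x y)
  rw [star_trivial, sub_mulVec, dotProduct_sub, sumElim_dotProduct_fromBlocks_mulVec, smul_mulVec,
    one_mulVec, dotProduct_smul, sumElim_dotProduct_sumElim, smul_eq_mul] at this
  linarith

/-- The form of `CᵀB⁻¹C` is at most `(L - μ) / L` times the form of `A`. -/
lemma Matrix.schurForm_le (hμ : 0 < μ) (hμL : μ ≤ L)
    (hlow : (fromBlocks A Cᵀ C B - μ • (1 : Matrix (m ⊕ n) (m ⊕ n) ℝ)).PosSemidef)
    (hup : (L • (1 : Matrix (m ⊕ n) (m ⊕ n) ℝ) - fromBlocks A Cᵀ C B).PosSemidef)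
    {x : m → ℝ} {y : n → ℝ} (hy : B *ᵥ y = C *ᵥ x) :
    B *ᵥ y ⬝ᵥ y ≤ (L - μ) / L * (A *ᵥ x ⬝ᵥ x) := by
  have hL : 0 < L := hμ.trans_le hμL
  have h₁ := le_blockForm_of_posSemidef_sub hlow x (-y)
  have h₂ := blockForm_le_of_posSemidef_sub hup x 0
  simp only [mulVec_neg, dotProduct_neg, neg_dotProduct, neg_neg, mulVec_zero, dotProduct_zero,
    mul_zero, add_zero, ← hy] at h₁ h₂
  have hyy : 0 ≤ y ⬝ᵥ y := by simpa using dotProduct_star_self_nonneg y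
  have h₃ : μ * (A *ᵥ x ⬝ᵥ x) ≤ L * (μ * (x ⬝ᵥ x)) := by nlinarith
  have h₄ : μ * (x ⬝ᵥ x) ≤ A *ᵥ x ⬝ᵥ x - B *ᵥ y ⬝ᵥ y := by nlinarith
  rw [div_mul_eq_mul_div, le_div_iff₀ hL]
  nlinarith

/-- One sweep of alternating minimization contracts the squared `A`-norm. -/
lemma Matrix.alternatingStep_form_le (hA : A.IsSymm) (hB : B.IsSymm) (hμ : 0 < μ) (hμL : μ ≤ L)
    (hlow : (fromBlocks A Cᵀ C B - μ • (1 : Matrix (m ⊕ n) (m ⊕ n) ℝ)).PosSemidef)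
    (hup : (L • (1 : Matrix (m ⊕ n) (m ⊕ n) ℝ) - fromBlocks A Cᵀ C B).PosSemidef)
    (u : m → ℝ) {v : m → ℝ} (hv : v = (A⁻¹ * Cᵀ * B⁻¹ * C) *ᵥ u) :
    A *ᵥ v ⬝ᵥ v ≤ ((L - μ) / L) ^ 2 * (A *ᵥ u ⬝ᵥ u) := by
  have hAdef : A.PosDef := posDef_of_le_dotProduct hA hμ fun x => by
    simpa using le_blockForm_of_posSemidef_sub hlow x 0
  have hBdef : B.PosDef := posDef_of_le_dotProduct hB hμ fun y => by
    simpa using le_blockForm_of_posSemidef_sub hlow 0 y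
  have hAu : IsUnit A.det := (isUnit_iff_isUnit_det A).1 hAdef.isUnit
  have hBu : IsUnit B.det := (isUnit_iff_isUnit_det B).1 hBdef.isUnit
  have hsolve (x : m → ℝ) : B *ᵥ (B⁻¹ *ᵥ (C *ᵥ x)) = C *ᵥ x := by
    rw [mulVec_mulVec, mul_nonsing_inv B hBu, one_mulVec]
  set p := B⁻¹ *ᵥ (C *ᵥ u) with hp
  set q := B⁻¹ *ᵥ (C *ᵥ v) with hq
  have hAv : A *ᵥ v = Cᵀ *ᵥ p := by
    rw [hv, hp, mulVec_mulVec, mulVec_mulVec, mulVec_mulVec, ← Matrix.mul_assoc,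
      ← Matrix.mul_assoc, ← Matrix.mul_assoc, mul_nonsing_inv A hAu, Matrix.one_mul]
  have hcross : A *ᵥ v ⬝ᵥ v = B *ᵥ q ⬝ᵥ p := by
    rw [hAv, hq, hsolve, mulVec_transpose, ← dotProduct_mulVec, dotProduct_comm]
  have hsymm : B *ᵥ p ⬝ᵥ q = B *ᵥ q ⬝ᵥ p := by
    rw [dotProduct_comm, dotProduct_mulVec, ← mulVec_transpose, hB.eq]
  have hexp (t : ℝ) : 2 * t * (A *ᵥ v ⬝ᵥ v) ≤ B *ᵥ q ⬝ᵥ q + t ^ 2 * (B *ᵥ p ⬝ᵥ p) := by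
    have h := hBdef.posSemidef.dotProduct_mulVec_nonneg (q - t • p)
    rw [star_trivial, dotProduct_comm] at h
    simp only [mulVec_sub, mulVec_smul, sub_dotProduct, dotProduct_sub, smul_dotProduct,
      dotProduct_smul, smul_eq_mul, hsymm, ← hcross] at h
    linarith
  have hkq := schurForm_le hμ hμL hlow hup (hsolve v)
  have hkp := schurForm_le hμ hμL hlow hup (hsolve u)
  have hρ : 0 ≤ (L - μ) / L := div_nonneg (sub_nonneg.2 hμL) (hμ.le.trans hμL)
  set ρ := (L - μ) / L
  rcases hρ.eq_or_lt with h0 | hpos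
  · have h := hexp 1
    rw [← h0] at hkq hkp ⊢
    linarith
  · have h := hexp ρ
    have h' := mul_le_mul_of_nonneg_left hkp (sq_nonneg ρ)
    refine le_of_mul_le_mul_left ?_ hpos
    linarith

end

/-- **Linear convergence of alternating minimization for the quadratic objective.**
If the symmetric block matrix `H = [[A, Cᵀ], [C, B]]` satisfies `μ•I ⪯ H ⪯ L•I` with
`0 < μ ≤ L`, then the iterates `θ_{k+1} = A⁻¹CᵀB⁻¹C θ_k` satisfy
`‖θ_k‖_A ≤ ((L-μ)/L)^k ‖θ₀‖_A` where `‖v‖_A = √⟨Av, v⟩`; in particular `θ_k → 0`. -/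
theorem quadratic_alternating_minimization_linear_rate {m n : ℕ}
    (A : Matrix (Fin m) (Fin m) ℝ) (B : Matrix (Fin n) (Fin n) ℝ)
    (C : Matrix (Fin n) (Fin m) ℝ) (hA : A.IsSymm) (hB : B.IsSymm)
    (μ L : ℝ) (hμ : 0 < μ) (hμL : μ ≤ L)
    (hlow : (Matrix.fromBlocks A Cᵀ C B - μ • (1 : Matrix (Fin m ⊕ Fin n) (Fin m ⊕ Fin n) ℝ)).PosSemidef)
    (hup : (L • (1 : Matrix (Fin m ⊕ Fin n) (Fin m ⊕ Fin n) ℝ) - Matrix.fromBlocks A Cᵀ C B).PosSemidef)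
    (θ : ℕ → Fin m → ℝ)
    (hseq : ∀ k : ℕ, θ (k + 1) = (A⁻¹ * Cᵀ * B⁻¹ * C).mulVec (θ k)) :
    (∀ k : ℕ, Real.sqrt (A.mulVec (θ k) ⬝ᵥ θ k) ≤
        ((L - μ) / L) ^ k * Real.sqrt (A.mulVec (θ 0) ⬝ᵥ θ 0)) ∧
      Filter.Tendsto θ Filter.atTop (nhds 0) := by
  have hL : 0 < L := hμ.trans_le hμL
  have hρ : 0 ≤ (L - μ) / L := div_nonneg (sub_nonneg.2 hμL) hL.le
  have hρ_lt : (L - μ) / L < 1 := (div_lt_one hL).2 (by linarith)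
  have hrate : ∀ k : ℕ, Real.sqrt (A.mulVec (θ k) ⬝ᵥ θ k) ≤
      ((L - μ) / L) ^ k * Real.sqrt (A.mulVec (θ 0) ⬝ᵥ θ 0) := by
    intro k
    induction k with
    | zero => simp
    | succ k ih =>
      have h := Real.sqrt_le_sqrt (alternatingStep_form_le hA hB hμ hμL hlow hup (θ k) (hseq k))
      rw [Real.sqrt_mul (sq_nonneg _), Real.sqrt_sq hρ] at h
      rw [pow_succ', mul_assoc]
      exact h.trans (mul_le_mul_of_nonneg_left ih hρ)
  refine ⟨hrate, tendsto_pi_nhds.2 fun i => ?_⟩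
  have hcoord (k : ℕ) : ‖θ k i‖ ≤
      ((L - μ) / L) ^ k * Real.sqrt (A.mulVec (θ 0) ⬝ᵥ θ 0) / Real.sqrt μ := by
    have hlow_k : μ * (θ k ⬝ᵥ θ k) ≤ A.mulVec (θ k) ⬝ᵥ θ k := by
      simpa using le_blockForm_of_posSemidef_sub hlow (θ k) 0
    have hi : θ k i ^ 2 ≤ θ k ⬝ᵥ θ k := by
      rw [sq]
      exact Finset.single_le_sum (f := fun j => θ k j * θ k j)
        (fun j _ => mul_self_nonneg _) (Finset.mem_univ i)
    rw [le_div_iff₀ (Real.sqrt_pos.2 hμ), Real.norm_eq_abs, ← Real.sqrt_sq_eq_abs,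
      ← Real.sqrt_mul (sq_nonneg _)]
    refine (Real.sqrt_le_sqrt ?_).trans (hrate k)
    nlinarith
  refine squeeze_zero_norm hcoord ?_
  simpa using ((tendsto_pow_atTop_nhds_zero_of_lt_one hρ hρ_lt).mul_const
    (Real.sqrt (A.mulVec (θ 0) ⬝ᵥ θ 0))).div_const (Real.sqrt μ)
end

section
/- Let E and F be real inner product spaces, and let f : E × F → ℝ be differentiable, strongly convex with parameter μ > 0 with respect to the norm on E × F, and have gradient that is Lipschitz continuous with constant L ≥ μ. Let 𝒳 ⊆ E and 𝒴 ⊆ F be convex sets, let (X*, Y*) ∈ 𝒳 × 𝒴 be a minimizer of f over 𝒳 × 𝒴 with f* := f(X*, Y*), and let sequences X_k ∈ 𝒳, Y_k ∈ 𝒴 be given such that for every k ≥ 0, Y_{k+1} minimizes Y ↦ f(X_k, Y) over 𝒴 and X_{k+1} minimizes X ↦ f(X, Y_{k+1}) over 𝒳. Then for every k ≥ 0, f(X_k, Y_k) − f* ≤ (1 − μ/L)^{2k} · (f(X₀, Y₀) − f*). -/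
open scoped RealInnerProductSpace

section ExactLineSearch

variable {H : Type*} [NormedAddCommGroup H] [InnerProductSpace ℝ H]

/-- The quadratic upper bound for a function with Lipschitz gradient. -/
lemma le_add_inner_add_sq_of_lipschitz_gradient [CompleteSpace H] {f : H → ℝ} {g : H → H}
    {L : ℝ} (hdiff : ∀ z, HasGradientAt f (g z) z)
    (hlip : ∀ z z' : H, ‖g z - g z'‖ ≤ L * ‖z - z'‖) (z d : H) :
    f (z + d) ≤ f z + ⟪g z, d⟫ + L / 2 * ‖d‖ ^ 2 := by
  let φ : ℝ → ℝ := fun t ↦ f (z + t • d) - t * ⟪g z, d⟫ - t ^ 2 * (L / 2 * ‖d‖ ^ 2)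
  have hφ (t : ℝ) : HasDerivAt φ
      (⟪g (z + t • d), d⟫ - ⟪g z, d⟫ - 2 * t * (L / 2 * ‖d‖ ^ 2)) t := by
    have hline : HasDerivAt (fun s : ℝ ↦ z + s • d) d t := by
      simpa using ((hasDerivAt_id t).smul_const d).const_add z
    have hf : HasDerivAt (fun s : ℝ ↦ f (z + s • d)) ⟪g (z + t • d), d⟫ t := by
      simpa [Function.comp_def] using (hdiff (z + t • d)).hasFDerivAt.comp_hasDerivAt t hline
    have hlin : HasDerivAt (fun s : ℝ ↦ s * ⟪g z, d⟫) ⟪g z, d⟫ t := by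
      simpa using (hasDerivAt_id t).mul_const ⟪g z, d⟫
    have hsq : HasDerivAt (fun s : ℝ ↦ s ^ 2 * (L / 2 * ‖d‖ ^ 2))
        (2 * t * (L / 2 * ‖d‖ ^ 2)) t := by
      simpa using (hasDerivAt_pow 2 t).mul_const (L / 2 * ‖d‖ ^ 2)
    exact (hf.sub hlin).sub hsq
  have hanti : AntitoneOn φ (Set.Icc 0 1) := by
    refine antitoneOn_of_deriv_nonpos (convex_Icc 0 1)
      (fun t _ ↦ (hφ t).continuousAt.continuousWithinAt)
      (fun t _ ↦ (hφ t).differentiableAt.differentiableWithinAt) fun t ht ↦ ?_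
    rw [interior_Icc] at ht
    rw [(hφ t).deriv, ← inner_sub_left]
    have hnorm : ‖g (z + t • d) - g z‖ ≤ L * (t * ‖d‖) := by
      simpa [norm_smul, abs_of_pos ht.1] using hlip (z + t • d) z
    nlinarith [real_inner_le_norm (g (z + t • d) - g z) d,
      mul_le_mul_of_nonneg_right hnorm (norm_nonneg d)]
  have h01 := hanti (Set.left_mem_Icc.2 zero_le_one) (Set.right_mem_Icc.2 zero_le_one) zero_le_one
  simp only [φ, one_smul, zero_smul, add_zero] at h01
  linarith

/-- The first-order optimality condition along a segment on which `z` is a minimizer. -/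
lemma inner_nonneg_of_le_on_segment {f : H → ℝ} {g : H → H} {L : ℝ} (hL : 0 ≤ L)
    (hup : ∀ z d, f (z + d) ≤ f z + ⟪g z, d⟫ + L / 2 * ‖d‖ ^ 2) {z q : H}
    (hmin : ∀ t ∈ Set.Icc (0 : ℝ) 1, f z ≤ f (z + t • q)) : 0 ≤ ⟪g z, q⟫ := by
  by_contra! hneg
  set c := ⟪g z, q⟫
  have hK : 0 ≤ L * ‖q‖ ^ 2 := by positivity
  have hden : 0 < L * ‖q‖ ^ 2 - c := by linarith
  set t := -c / (L * ‖q‖ ^ 2 - c) with ht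
  have ht0 : 0 < t := div_pos (by linarith) hden
  have ht1 : t ≤ 1 := (div_le_one hden).2 (by linarith)
  have hmul : t * (L * ‖q‖ ^ 2 - c) = -c := div_mul_cancel₀ _ hden.ne'
  have h := (hmin t ⟨ht0.le, ht1⟩).trans (hup z (t • q))
  rw [inner_smul_right, norm_smul, mul_pow, Real.norm_eq_abs, sq_abs] at h
  have h' : 0 ≤ t * (c + t * (L * ‖q‖ ^ 2) / 2) := by
    change _ ≤ f z + t * c + _ at h
    linarith
  have := nonneg_of_mul_nonneg_right h' ht0
  nlinarith

/-- One exact minimization in the direction `p`, started at a point which is already optimal in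
the orthogonal direction `q`, contracts the functional residual by `(1 - μ / L) ^ 2`. -/
lemma line_search_contraction {f : H → ℝ} {g : H → H} {μ L : ℝ} (hμ : 0 < μ) (hμL : μ ≤ L)
    (hlow : ∀ z z' : H, f z + ⟪g z, z' - z⟫ + μ / 2 * ‖z' - z‖ ^ 2 ≤ f z')
    (hup : ∀ z d, f (z + d) ≤ f z + ⟪g z, d⟫ + L / 2 * ‖d‖ ^ 2)
    {z p q : H} {m : ℝ} (hpq : ⟪p, q⟫ = 0) (hopt : f (z + (p + q)) ≤ f z)
    (hq : ∀ t ∈ Set.Icc (0 : ℝ) 1, f z ≤ f (z + t • q))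
    (hm : ∀ t ∈ Set.Icc (0 : ℝ) 1, m ≤ f (z + t • p)) :
    m - f (z + (p + q)) ≤ (1 - μ / L) ^ 2 * (f z - f (z + (p + q))) := by
  have hL : 0 < L := hμ.trans_le hμL
  have hB : 0 ≤ ⟪g z, q⟫ := inner_nonneg_of_le_on_segment hL.le hup hq
  have hnorm (a b : ℝ) : ‖a • p + b • q‖ ^ 2 = a ^ 2 * ‖p‖ ^ 2 + b ^ 2 * ‖q‖ ^ 2 := by
    rw [norm_add_sq_real, inner_smul_left, inner_smul_right, hpq, norm_smul, norm_smul, mul_pow,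
      mul_pow, Real.norm_eq_abs, Real.norm_eq_abs, sq_abs, sq_abs]
    simp
  have hinner (w : H) (a b : ℝ) : ⟪w, a • p + b • q⟫ = a * ⟪w, p⟫ + b * ⟪w, q⟫ := by
    rw [inner_add_right, inner_smul_right, inner_smul_right]
  have hlow' (w w' : H) (a b : ℝ) (hw : w' - w = a • p + b • q) :
      f w + (a * ⟪g w, p⟫ + b * ⟪g w, q⟫) + μ / 2 * (a ^ 2 * ‖p‖ ^ 2 + b ^ 2 * ‖q‖ ^ 2)
        ≤ f w' := by
    simpa only [hw, hnorm, hinner] using hlow w w'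
  have hup' (a b : ℝ) : f (z + (a • p + b • q)) ≤ f z + (a * ⟪g z, p⟫ + b * ⟪g z, q⟫)
      + L / 2 * (a ^ 2 * ‖p‖ ^ 2 + b ^ 2 * ‖q‖ ^ 2) := by
    simpa only [hnorm, hinner] using hup z (a • p + b • q)
  have hstart := hlow' z (z + (p + q)) 1 1 (by module)
  have hA : ⟪g z, p⟫ ≤ 0 := by
    have : 0 ≤ μ / 2 * (1 ^ 2 * ‖p‖ ^ 2 + 1 ^ 2 * ‖q‖ ^ 2) := by positivity
    linarith
  obtain ⟨t, ht, ht0, ht1⟩ : ∃ t ∈ Set.Icc (0 : ℝ) 1, t * (L * t * ‖p‖ ^ 2 + ⟪g z, p⟫) ≤ 0 ∧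
      0 ≤ (1 - t) * (L * t * ‖p‖ ^ 2 + ⟪g z, p⟫) := by
    rcases le_or_gt (L * ‖p‖ ^ 2) (-⟪g z, p⟫) with h | h
    · exact ⟨1, by simp, by linarith, by simp⟩
    · have hK : 0 < L * ‖p‖ ^ 2 := by linarith
      have h0 : L * (-⟪g z, p⟫ / (L * ‖p‖ ^ 2)) * ‖p‖ ^ 2 + ⟪g z, p⟫ = 0 := by
        rw [mul_right_comm, mul_div_cancel₀ _ hK.ne']
        ring
      refine ⟨-⟪g z, p⟫ / (L * ‖p‖ ^ 2),
        ⟨div_nonneg (by linarith) hK.le, (div_le_one hK).2 h.le⟩, ?_, ?_⟩ <;> simp [h0]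
  refine (sub_le_sub_right (hm t ht) _).trans ?_
  have hend := hlow' (z + t • p) (z + (p + q)) (1 - t) 1 (by module)
  rcases hμL.eq_or_lt with rfl | hlt
  · have hstep := hup' t 0
    rw [zero_smul, add_zero] at hstep
    have hP : 0 ≤ μ / 2 * ((1 - t) ^ 2 * ‖p‖ ^ 2 + ‖q‖ ^ 2) := by positivity
    rw [div_self hμ.ne']
    linarith
  · have hr : 0 < L - μ := sub_pos.2 hlt
    set a := (μ - L * t) / (L - μ) with ha
    set b := μ / (L - μ) with hb
    have hmid := (hlow' (z + t • p) (z + ((-a) • p + (-b) • q)) (-a - t) (-b) (by module)).trans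
      (hup' (-a) (-b))
    have hkey : L ^ 2 * (f (z + t • p) - f (z + (p + q))) ≤
        (L - μ) ^ 2 * (f z - f (z + (p + q))) := by
      have hmid' : (L - μ) * L * (f (z + t • p) - f z) - L * μ * (1 - t) * ⟪g (z + t • p), p⟫
          - L * μ * ⟪g (z + t • p), q⟫ + L * (μ - L * t) * ⟪g z, p⟫ + L * μ * ⟪g z, q⟫
          + ((L - μ) * L * μ / 2 * t ^ 2 + L * μ * t * (μ - L * t) - L / 2 * (μ - L * t) ^ 2)
            * ‖p‖ ^ 2 - L / 2 * μ ^ 2 * ‖q‖ ^ 2 ≤ 0 := by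
        have h := mul_nonpos_of_nonneg_of_nonpos (mul_pos hr hL).le (sub_nonpos.2 hmid)
        refine le_of_eq_of_le ?_ h
        rw [ha, hb]
        field_simp
        ring
      have hend' := mul_le_mul_of_nonneg_left hend (mul_pos hμ hL).le
      have hstart' := mul_le_mul_of_nonneg_left hstart (mul_pos hμ hr).le
      have hr2 : 0 ≤ L ^ 2 - (L - μ) ^ 2 := by nlinarith
      have hnormal₁ := mul_nonpos_of_nonneg_of_nonpos (sq_nonneg (L - μ)) ht0
      have hnormal₂ := mul_nonneg hr2 (add_nonneg ht1 hB)
      have hslack : 0 ≤ (L - μ) / 2 * ((μ - L * t) ^ 2 * ‖p‖ ^ 2 + μ ^ 2 * ‖q‖ ^ 2) := by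
        positivity
      linarith
    have hL2 : (1 - μ / L) ^ 2 = (L - μ) ^ 2 / L ^ 2 := by field_simp
    rw [hL2, div_mul_eq_mul_div, le_div_iff₀ (by positivity)]
    linarith

end ExactLineSearch

/-- **Global linear convergence of alternating minimization** (rate `(1 - μ/L)^{2k}` for the
functional residual). `f` is differentiable with gradient `g`, strongly convex with parameter
`μ > 0`, with `L`-Lipschitz gradient, on the ℓ²-product `WithLp 2 (E × F)`; `X_{k}`, `Y_{k}`
are exact alternating minimizers over the convex sets `𝒳`, `𝒴`. -/
theorem alternating_minimization_strongly_convex_rate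
    {E F : Type*} [NormedAddCommGroup E] [InnerProductSpace ℝ E] [CompleteSpace E]
    [NormedAddCommGroup F] [InnerProductSpace ℝ F] [CompleteSpace F]
    (f : WithLp 2 (E × F) → ℝ) (g : WithLp 2 (E × F) → WithLp 2 (E × F))
    (hdiff : ∀ z, HasGradientAt f (g z) z)
    (μ L : ℝ) (hμ : 0 < μ) (hμL : μ ≤ L)
    (hsc : ∀ z z' : WithLp 2 (E × F),
      f z + ⟪g z, z' - z⟫ + μ / 2 * ‖z' - z‖ ^ 2 ≤ f z')
    (hlip : ∀ z z' : WithLp 2 (E × F), ‖g z - g z'‖ ≤ L * ‖z - z'‖)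
    (𝒳 : Set E) (𝒴 : Set F) (hXconv : Convex ℝ 𝒳) (hYconv : Convex ℝ 𝒴)
    (Xs : E) (Ys : F) (hXs : Xs ∈ 𝒳) (hYs : Ys ∈ 𝒴)
    (hmin : ∀ x ∈ 𝒳, ∀ y ∈ 𝒴,
      f ((WithLp.equiv 2 (E × F)).symm (Xs, Ys)) ≤ f ((WithLp.equiv 2 (E × F)).symm (x, y)))
    (X : ℕ → E) (Y : ℕ → F) (hXmem : ∀ k, X k ∈ 𝒳) (hYmem : ∀ k, Y k ∈ 𝒴)
    (hYstep : ∀ k : ℕ, ∀ y ∈ 𝒴,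
      f ((WithLp.equiv 2 (E × F)).symm (X k, Y (k + 1))) ≤
        f ((WithLp.equiv 2 (E × F)).symm (X k, y)))
    (hXstep : ∀ k : ℕ, ∀ x ∈ 𝒳,
      f ((WithLp.equiv 2 (E × F)).symm (X (k + 1), Y (k + 1))) ≤
        f ((WithLp.equiv 2 (E × F)).symm (x, Y (k + 1)))) :
    ∀ k : ℕ,
      f ((WithLp.equiv 2 (E × F)).symm (X k, Y k)) -
          f ((WithLp.equiv 2 (E × F)).symm (Xs, Ys)) ≤
        (1 - μ / L) ^ (2 * k) *
          (f ((WithLp.equiv 2 (E × F)).symm (X 0, Y 0)) -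
            f ((WithLp.equiv 2 (E × F)).symm (Xs, Ys))) := by
  have hL : 0 < L := hμ.trans_le hμL
  have hup := le_add_inner_add_sq_of_lipschitz_gradient hdiff hlip
  have hstep (k : ℕ) :
      f (WithLp.toLp 2 (X (k + 1), Y (k + 1))) - f (WithLp.toLp 2 (Xs, Ys)) ≤
        (1 - μ / L) ^ 2 *
          (f (WithLp.toLp 2 (X k, Y (k + 1))) - f (WithLp.toLp 2 (Xs, Ys))) := by
    let p : WithLp 2 (E × F) := WithLp.toLp 2 (Xs - X k, 0)
    let q : WithLp 2 (E × F) := WithLp.toLp 2 (0, Ys - Y (k + 1))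
    have hsum : WithLp.toLp 2 (X k, Y (k + 1)) + (p + q) = WithLp.toLp 2 (Xs, Ys) := by
      simp [p, q, ← WithLp.toLp_add]
    have hp (t : ℝ) : WithLp.toLp 2 (X k, Y (k + 1)) + t • p =
        WithLp.toLp 2 (X k + t • (Xs - X k), Y (k + 1)) := by
      simp [p, ← WithLp.toLp_add, ← WithLp.toLp_smul]
    have hq (t : ℝ) : WithLp.toLp 2 (X k, Y (k + 1)) + t • q =
        WithLp.toLp 2 (X k, Y (k + 1) + t • (Ys - Y (k + 1))) := by
      simp [q, ← WithLp.toLp_add, ← WithLp.toLp_smul]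
    rw [← hsum]
    refine line_search_contraction hμ hμL hsc hup (by simp [p, q]) ?_ (fun t ht ↦ ?_)
      fun t ht ↦ ?_
    · rw [hsum]
      exact hmin _ (hXmem k) _ (hYmem (k + 1))
    · rw [hq]
      exact hYstep k _ (hYconv.add_smul_sub_mem (hYmem (k + 1)) hYs ht)
    · rw [hp]
      exact hXstep k _ (hXconv.add_smul_sub_mem (hXmem k) hXs ht)
  intro k
  induction k with
  | zero => simp
  | succ k ih =>
    rw [mul_add, pow_add, mul_right_comm, mul_comm _ ((1 - μ / L) ^ (2 * 1))]
    refine (hstep k).trans (mul_le_mul_of_nonneg_left ?_ (sq_nonneg _))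
    exact (sub_le_sub_right (hYstep k _ (hYmem k)) _).trans ih
end

section
/- Let E and F be real inner product spaces, and let f : E × F → ℝ be differentiable, strongly convex with parameter μ > 0, with L-Lipschitz gradient (L ≥ μ). Let 𝒳 ⊆ E and 𝒴 ⊆ F be convex sets, let (X*, Y*) ∈ 𝒳 × 𝒴 minimize f over 𝒳 × 𝒴 with f* := f(X*, Y*). Suppose X_k ∈ 𝒳, Y_{k+1} ∈ 𝒴, X_{k+1} ∈ 𝒳 are such that Y_{k+1} minimizes Y ↦ f(X_k, Y) over 𝒴 and X_{k+1} minimizes X ↦ f(X, Y_{k+1}) over 𝒳. Then f(X_{k+1}, Y_{k+1}) − f* ≤ (1 − μ/L) · (f(X_k, Y_{k+1}) − f*). -/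
open scoped RealInnerProductSpace

section GradientInequalities

variable {V : Type*} [NormedAddCommGroup V] [InnerProductSpace ℝ V] [CompleteSpace V]

/-- Descent lemma: quadratic upper bound for a function with Lipschitz gradient. -/
theorem le_quadratic_of_lipschitz_gradient {f : V → ℝ} {g : V → V} {L : ℝ}
    (hdiff : ∀ z, HasGradientAt f (g z) z) (hlip : ∀ z z', ‖g z - g z'‖ ≤ L * ‖z - z'‖)
    (z d : V) : f (z + d) ≤ f z + ⟪g z, d⟫ + L / 2 * ‖d‖ ^ 2 := by
  have hderiv (t : ℝ) : HasDerivAt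
      (fun t : ℝ => f (z + t • d) - t * ⟪g z, d⟫ - L / 2 * ‖d‖ ^ 2 * t ^ 2)
      (⟪g (z + t • d), d⟫ - ⟪g z, d⟫ - L * ‖d‖ ^ 2 * t) t := by
    have hline : HasDerivAt (fun t : ℝ => z + t • d) d t := by
      simpa using ((hasDerivAt_id t).smul_const d).const_add z
    have hf := (hdiff (z + t • d)).hasFDerivAt.comp_hasDerivAt t hline
    rw [InnerProductSpace.toDual_apply_apply] at hf
    refine ((hf.sub ((hasDerivAt_id t).mul_const ⟪g z, d⟫)).sub
      ((hasDerivAt_pow 2 t).const_mul (L / 2 * ‖d‖ ^ 2))).congr_deriv ?_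
    push_cast
    ring
  have hanti : AntitoneOn
      (fun t : ℝ => f (z + t • d) - t * ⟪g z, d⟫ - L / 2 * ‖d‖ ^ 2 * t ^ 2) (Set.Ici 0) := by
    refine antitoneOn_of_hasDerivWithinAt_nonpos (convex_Ici 0)
      (fun t _ => (hderiv t).continuousAt.continuousWithinAt)
      (fun t _ => (hderiv t).hasDerivWithinAt) fun t ht => ?_
    rw [interior_Ici, Set.mem_Ioi] at ht
    have hg := hlip (z + t • d) z
    rw [add_sub_cancel_left, norm_smul, Real.norm_of_nonneg ht.le] at hg
    have hinner := real_inner_le_norm (g (z + t • d) - g z) d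
    rw [inner_sub_left] at hinner
    nlinarith [mul_le_mul_of_nonneg_right hg (norm_nonneg d)]
  have h := hanti (Set.mem_Ici.2 le_rfl) (Set.mem_Ici.2 zero_le_one) zero_le_one
  simp only [one_smul, zero_smul, add_zero] at h
  linarith

/-- First-order optimality condition along a segment. -/
theorem inner_gradient_nonneg_of_isMinOn_segment {f : V → ℝ} {v z z' : V}
    (hf : HasGradientAt f v z) (hmin : IsMinOn f (segment ℝ z z') z) :
    0 ≤ ⟪v, z' - z⟫ := by
  have h := hmin.localize.hasFDerivWithinAt_nonneg hf.hasFDerivAt.hasFDerivWithinAt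
    (sub_mem_posTangentConeAt_of_segment_subset subset_rfl)
  rwa [InnerProductSpace.toDual_apply_apply] at h

end GradientInequalities

/-- **Per-step contraction of the functional residual** (X-update step):
`f(X_{k+1}, Y_{k+1}) - f* ≤ (1 - μ/L) (f(X_k, Y_{k+1}) - f*)` for exact alternating
minimization of a `μ`-strongly convex function with `L`-Lipschitz gradient over convex sets. -/
theorem alternating_minimization_step_contraction_X
    {E F : Type*} [NormedAddCommGroup E] [InnerProductSpace ℝ E] [CompleteSpace E]
    [NormedAddCommGroup F] [InnerProductSpace ℝ F] [CompleteSpace F]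
    (f : WithLp 2 (E × F) → ℝ) (g : WithLp 2 (E × F) → WithLp 2 (E × F))
    (hdiff : ∀ z, HasGradientAt f (g z) z)
    (μ L : ℝ) (hμ : 0 < μ) (hμL : μ ≤ L)
    (hsc : ∀ z z' : WithLp 2 (E × F),
      f z + ⟪g z, z' - z⟫ + μ / 2 * ‖z' - z‖ ^ 2 ≤ f z')
    (hlip : ∀ z z' : WithLp 2 (E × F), ‖g z - g z'‖ ≤ L * ‖z - z'‖)
    (𝒳 : Set E) (𝒴 : Set F) (hXconv : Convex ℝ 𝒳) (hYconv : Convex ℝ 𝒴)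
    (Xs : E) (Ys : F) (hXs : Xs ∈ 𝒳) (hYs : Ys ∈ 𝒴)
    (hmin : ∀ x ∈ 𝒳, ∀ y ∈ 𝒴,
      f ((WithLp.equiv 2 (E × F)).symm (Xs, Ys)) ≤ f ((WithLp.equiv 2 (E × F)).symm (x, y)))
    (Xk : E) (Yk1 : F) (Xk1 : E)
    (hXk : Xk ∈ 𝒳) (hYk1 : Yk1 ∈ 𝒴) (hXk1 : Xk1 ∈ 𝒳)
    (hYstep : ∀ y ∈ 𝒴,
      f ((WithLp.equiv 2 (E × F)).symm (Xk, Yk1)) ≤ f ((WithLp.equiv 2 (E × F)).symm (Xk, y)))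
    (hXstep : ∀ x ∈ 𝒳,
      f ((WithLp.equiv 2 (E × F)).symm (Xk1, Yk1)) ≤ f ((WithLp.equiv 2 (E × F)).symm (x, Yk1))) :
    f ((WithLp.equiv 2 (E × F)).symm (Xk1, Yk1)) - f ((WithLp.equiv 2 (E × F)).symm (Xs, Ys)) ≤
      (1 - μ / L) *
        (f ((WithLp.equiv 2 (E × F)).symm (Xk, Yk1)) -
          f ((WithLp.equiv 2 (E × F)).symm (Xs, Ys))) := by
  have hL : 0 < L := hμ.trans_le hμL
  simp only [WithLp.equiv_symm_apply] at *
  set z : WithLp 2 (E × F) := WithLp.toLp 2 (Xk, Yk1) with hz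
  set zs : WithLp 2 (E × F) := WithLp.toLp 2 (Xs, Ys) with hzs
  set dx : WithLp 2 (E × F) := WithLp.toLp 2 (Xs - Xk, 0) with hdx
  have hopt : 0 ≤ ⟪g z, WithLp.toLp 2 (Xk, Ys) - z⟫ := by
    refine inner_gradient_nonneg_of_isMinOn_segment (hdiff z) ?_
    rintro _ ⟨a, b, ha, hb, hab, rfl⟩
    have h := hYstep _ (hYconv hYk1 hYs ha hb hab)
    have heq : a • z + b • WithLp.toLp 2 (Xk, Ys) = WithLp.toLp 2 (Xk, a • Yk1 + b • Ys) := by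
      rw [hz, ← WithLp.toLp_smul, ← WithLp.toLp_smul, ← WithLp.toLp_add, Prod.smul_mk,
        Prod.smul_mk, Prod.mk_add_mk, ← add_smul, hab, one_smul]
    simpa only [Set.mem_ofPred_eq, heq] using h
  have hsplit : zs - z = dx + (WithLp.toLp 2 (Xk, Ys) - z) := by
    rw [hz, hzs, hdx, ← WithLp.toLp_sub, ← WithLp.toLp_sub, ← WithLp.toLp_add]
    simp
  have hnorm : ‖dx‖ ^ 2 ≤ ‖zs - z‖ ^ 2 := by
    rw [WithLp.prod_norm_sq_eq_of_L2, WithLp.prod_norm_sq_eq_of_L2]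
    simp [hz, hzs, hdx]
  have hlower := hsc z zs
  rw [hsplit, inner_add_right, ← hsplit] at hlower
  have hdescent := le_quadratic_of_lipschitz_gradient hdiff hlip z ((μ / L) • dx)
  rw [inner_smul_right, norm_smul, Real.norm_of_nonneg (div_pos hμ hL).le, mul_pow] at hdescent
  have hγ : L / 2 * ((μ / L) ^ 2 * ‖dx‖ ^ 2) = μ / L * (μ / 2 * ‖dx‖ ^ 2) := by
    field_simp
  have hstep : f (WithLp.toLp 2 (Xk1, Yk1)) ≤ f (z + (μ / L) • dx) := by
    have hmem := hXconv.add_smul_sub_mem hXk hXs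
      ⟨(div_pos hμ hL).le, (div_le_one hL).2 hμL⟩
    have heq : z + (μ / L) • dx = WithLp.toLp 2 (Xk + (μ / L) • (Xs - Xk), Yk1) := by
      rw [hz, hdx, ← WithLp.toLp_smul, ← WithLp.toLp_add]
      simp
    rw [heq]
    exact hXstep _ hmem
  have hbound : ⟪g z, dx⟫ + μ / 2 * ‖dx‖ ^ 2 ≤ f zs - f z := by
    linarith [mul_le_mul_of_nonneg_left hnorm (half_pos hμ).le]
  linarith [mul_le_mul_of_nonneg_left hbound (div_pos hμ hL).le]
end
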